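/- arXiv:1509.00438 — 2 statements merged into one kernel-verified Lean document; each statement's English description precedes it below -/
import Mathlib

section
/- For every n ≥ 2 and 1 ≤ i ≤ n−1, the operators t_i, t_i′ and U_i on V^{⊗n} commute with the quantum sl₂ operators: t_i∘E = E∘t_i, t_i∘F = F∘t_i, t_i′∘E = E∘t_i′, t_i′∘F = F∘t_i′, U_i∘E = E∘U_i, and U_i∘F = F∘U_i. -/
set_option maxHeartbeats 1000000
set_option synthInstance.maxHeartbeats 400000

/-! Common setup: `Fq = ℚ(q)`, the tensor power `V^{⊗n}` of `V = Fq²` realized as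
functions on the set of `{0,1}`-sequences (its standard basis), the Temperley-Lieb
and braid operators `U_i, t_i, t_i'`, the quantum `sl₂` operators `E, F, K^{⊗n}`,
weight spaces, quantum integers and the Jones-Wenzl operators. -/

noncomputable section

/-- The field `ℚ(q)` of rational functions. -/
abbrev Fq := RatFunc ℚ

/-- The variable `q`. -/
def q : Fq := RatFunc.X

/-- `V^{⊗n}` for `V = Fq²`: functions on the index set of the standard basis
`v_{i₁} ⊗ ⋯ ⊗ v_{iₙ}`, `i_r ∈ {0,1}` (here `false ↔ v₀`, `true ↔ v₁`). -/
abbrev Tens (n : ℕ) := (Fin n → Bool) → Fq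

/-- Coefficients of `Ũ` on `V ⊗ V`: `uCoef a b c d` is the coefficient of
`v_c ⊗ v_d` in `Ũ(v_a ⊗ v_b)`. -/
def uCoef : Bool → Bool → Bool → Bool → Fq
  | false, true, true, false => 1
  | false, true, false, true => -q
  | true, false, true, false => -q⁻¹
  | true, false, false, true => 1
  | _, _, _, _ => 0

/-- Coefficients of `t̃` on `V ⊗ V`. -/
def tCoef : Bool → Bool → Bool → Bool → Fq
  | false, false, false, false => 1
  | true, true, true, true => 1
  | false, true, true, false => q
  | false, true, false, true => 1 - q ^ 2
  | true, false, false, true => q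
  | _, _, _, _ => 0

/-- Coefficients of `t̃′` on `V ⊗ V`. -/
def tpCoef : Bool → Bool → Bool → Bool → Fq
  | false, false, false, false => 1
  | true, true, true, true => 1
  | false, true, true, false => q⁻¹
  | true, false, true, false => 1 - (q ^ 2)⁻¹
  | true, false, false, true => q⁻¹
  | _, _, _, _ => 0

/-- Matrix of the operator `id^{⊗(i-1)} ⊗ T ⊗ id^{⊗(n-i-1)}` acting on the
(1-based) tensor factors `i, i+1` of `V^{⊗n}`, where `T` has coefficient matrix `m`:
the `(t, s)` entry is the coefficient of the basis vector indexed by `t` in the image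
of the basis vector indexed by `s`. -/
def locMat (n : ℕ) (m : Bool → Bool → Bool → Bool → Fq) (i : ℕ) :
    Matrix (Fin n → Bool) (Fin n → Bool) Fq := fun t s =>
  if h : 1 ≤ i ∧ i < n then
    let i0 : Fin n := ⟨i - 1, by omega⟩
    let i1 : Fin n := ⟨i, by omega⟩
    if s = Function.update (Function.update t i0 (s i0)) i1 (s i1) then
      m (s i0) (s i1) (t i0) (t i1)
    else 0
  else 0

/-- The Temperley-Lieb operator `U_i = id^{⊗(i-1)} ⊗ Ũ ⊗ id^{⊗(n-i-1)}` (1-based `i`). -/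
def Uop (n i : ℕ) : Module.End Fq (Tens n) := (locMat n uCoef i).mulVecLin

/-- The braid operator `t_i = id^{⊗(i-1)} ⊗ t̃ ⊗ id^{⊗(n-i-1)}` (1-based `i`). -/
def tOp (n i : ℕ) : Module.End Fq (Tens n) := (locMat n tCoef i).mulVecLin

/-- The inverse braid operator `t_i′ = id^{⊗(i-1)} ⊗ t̃′ ⊗ id^{⊗(n-i-1)}` (1-based `i`). -/
def tpOp (n i : ℕ) : Module.End Fq (Tens n) := (locMat n tpCoef i).mulVecLin

/-- Number of indices `r` with `i_r = 1` in the basis index `s`. -/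
def countOnes {n : ℕ} (s : Fin n → Bool) : ℕ := (Finset.univ.filter fun r => s r = true).card

/-- The weight space `W_k = V₁^{⊗n}[-n+2k]`: the span of the standard basis vectors
with exactly `k` of the `i_r` equal to `1`. -/
def weightSpace (n k : ℕ) : Submodule Fq (Tens n) :=
  Submodule.span Fq {ψ : Tens n | ∃ s : Fin n → Bool, countOnes s = k ∧ ψ = Pi.single s 1}

/-- Eigenvalue of `K` on `v_b`. -/
def kval (b : Bool) : Fq := if b then q else q⁻¹

/-- Matrix of `E = Σ_j K^{⊗(j-1)} ⊗ e ⊗ id^{⊗(n-j)}` on `V^{⊗n}`. -/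
def Emat (n : ℕ) : Matrix (Fin n → Bool) (Fin n → Bool) Fq := fun t s =>
  ∑ j : Fin n,
    if s j = false ∧ t = Function.update s j true then
      ∏ r ∈ Finset.univ.filter fun r => r < j, kval (s r)
    else 0

/-- Matrix of `F = Σ_j id^{⊗(j-1)} ⊗ f ⊗ (K⁻¹)^{⊗(n-j)}` on `V^{⊗n}`. -/
def Fmat (n : ℕ) : Matrix (Fin n → Bool) (Fin n → Bool) Fq := fun t s =>
  ∑ j : Fin n,
    if s j = true ∧ t = Function.update s j false then
      ∏ r ∈ Finset.univ.filter fun r => j < r, (kval (s r))⁻¹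
    else 0

/-- The operator `E` on `V^{⊗n}`. -/
def Eop (n : ℕ) : Module.End Fq (Tens n) := (Emat n).mulVecLin

/-- The operator `F` on `V^{⊗n}`. -/
def Fop (n : ℕ) : Module.End Fq (Tens n) := (Fmat n).mulVecLin

/-- The operator `𝐊 = K^{⊗n}` on `V^{⊗n}`. -/
def Kop (n : ℕ) : Module.End Fq (Tens n) :=
  (Matrix.diagonal fun s : Fin n → Bool => ∏ r, kval (s r)).mulVecLin

/-- The operator `𝐊⁻¹ = (K⁻¹)^{⊗n}` on `V^{⊗n}`. -/
def Kinvop (n : ℕ) : Module.End Fq (Tens n) :=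
  (Matrix.diagonal fun s : Fin n → Bool => (∏ r, kval (s r))⁻¹).mulVecLin

/-- The quantum integer `[m] = (q^m - q^{-m})/(q - q⁻¹)`. -/
def qint (m : ℕ) : Fq := (q ^ m - q⁻¹ ^ m) / (q - q⁻¹)

/-- The quantum factorial `[m]! = [1][2]⋯[m]`. -/
def qfact (m : ℕ) : Fq := ∏ i ∈ Finset.range m, qint (i + 1)

/-- The quantum binomial coefficient `[n choose k] = [n]!/([k]!·[n-k]!)`. -/
def qbinom (n k : ℕ) : Fq := qfact n / (qfact k * qfact (n - k))

/-- The divided power `E^{(k)} = E^k/[k]!`. -/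
def Ediv (n k : ℕ) : Module.End Fq (Tens n) := (qfact k)⁻¹ • (Eop n) ^ k

/-- The divided power `F^{(k)} = F^k/[k]!`. -/
def Fdiv (n k : ℕ) : Module.End Fq (Tens n) := (qfact k)⁻¹ • (Fop n) ^ k

/-- The operator `P_k = (1/[n choose k])·E^{(k)} ∘ F^{(k)}` (the Jones-Wenzl projector
on the weight space `W_k`). -/
def JW (n k : ℕ) : Module.End Fq (Tens n) := (qbinom n k)⁻¹ • (Ediv n k ∘ₗ Fdiv n k)

/-- The vectors `l_r` (1-based): `l_r = v₀^{⊗(r-1)} ⊗ (v₁⊗v₀ - q·v₀⊗v₁) ⊗ v₀^{⊗(n-r-1)}`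
for `r ≠ n`, and `l_n = v₀^{⊗(n-1)} ⊗ v₁`. -/
def ell (n j : ℕ) : Tens n :=
  if j = n then Pi.single (fun r => decide (r.val = n - 1)) 1
  else (Pi.single (fun r => decide (r.val = j - 1)) 1 : Tens n)
      - q • (Pi.single (fun r => decide (r.val = j)) 1 : Tens n)

/-- The span of `l_1, …, l_n`. -/
def ellSpan (n : ℕ) : Submodule Fq (Tens n) :=
  Submodule.span Fq {v : Tens n | ∃ j, 1 ≤ j ∧ j ≤ n ∧ v = ell n j}

open Function in
/-- Replace the entries of `t` at the positions `i` and `j` by `a` and `b`. -/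
abbrev update₂ {n : ℕ} (i j : Fin n) (t : Fin n → Bool) (a b : Bool) : Fin n → Bool :=
  update (update t i a) j b

lemma q_ne_zero : q ≠ 0 := RatFunc.X_ne_zero

/-- The operator flipping the `j`-th entry to `b`, weighted by the product of `g` over the
entries at the positions in `S`. -/
def flipOp {n : ℕ} (b : Bool) (g : Bool → Fq) (S : Finset (Fin n)) (j : Fin n) (ψ : Tens n) :
    Tens n := fun t =>
  if t j = b then (∏ r ∈ S, g (t r)) * ψ (Function.update t j (!b)) else 0

/-- The matrix-vector product for a sum of weighted flips. -/
lemma flip_matrix_mulVec {n : ℕ} (b : Bool) (g : Bool → Fq) (S : Fin n → Finset (Fin n))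
    (hS : ∀ j, j ∉ S j) (ψ : Tens n) :
    (Matrix.of fun t s : Fin n → Bool => ∑ j : Fin n,
      if s j = (!b) ∧ t = Function.update s j b then ∏ r ∈ S j, g (s r) else 0).mulVec ψ
      = ∑ j, flipOp b g (S j) j ψ := by
  funext t
  simp only [Matrix.mulVec, dotProduct, Matrix.of_apply, Finset.sum_mul, Finset.sum_apply]
  rw [Finset.sum_comm]
  refine Finset.sum_congr rfl fun j _ => ?_
  rw [Finset.sum_eq_single (Function.update t j (!b))]
  · have hprod : ∏ r ∈ S j, g (Function.update t j (!b) r) = ∏ r ∈ S j, g (t r) :=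
      Finset.prod_congr rfl fun r hr => by
        rw [Function.update_of_ne (by rintro rfl; exact hS _ hr)]
    by_cases h : t j = b
    · subst h
      simp [flipOp, hprod]
    · have h' : t ≠ Function.update t j b := fun h' => h (by rw [h']; simp)
      simp [flipOp, h, h']
  · intro s _ hs
    rw [if_neg, zero_mul]
    rintro ⟨h1, rfl⟩
    apply hs
    simp [← h1]
  · simp

lemma Eop_apply {n : ℕ} (ψ : Tens n) :
    Eop n ψ = ∑ j, flipOp true kval (Finset.univ.filter fun r => r < j) j ψ :=
  flip_matrix_mulVec true kval (fun j => Finset.univ.filter fun r => r < j) (by simp) ψ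

lemma Fop_apply {n : ℕ} (ψ : Tens n) :
    Fop n ψ = ∑ j, flipOp false (fun b => (kval b)⁻¹) (Finset.univ.filter fun r => j < r) j ψ :=
  flip_matrix_mulVec false (fun b => (kval b)⁻¹) (fun j => Finset.univ.filter fun r => j < r)
    (by simp) ψ

/-- The action of a two-site operator on coordinates. -/
lemma locMat_mulVec {n : ℕ} (m : Bool → Bool → Bool → Bool → Fq) (i : ℕ) (h1 : 1 ≤ i)
    (h2 : i < n) (ψ : Tens n) (t : Fin n → Bool) :
    (locMat n m i).mulVec ψ t = ∑ p : Bool × Bool,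
      m p.1 p.2 (t ⟨i - 1, by omega⟩) (t ⟨i, h2⟩) *
        ψ (update₂ ⟨i - 1, by omega⟩ ⟨i, h2⟩ t p.1 p.2) := by
  have hne : (⟨i - 1, by omega⟩ : Fin n) ≠ ⟨i, h2⟩ := by
    simp only [ne_eq, Fin.mk.injEq]; omega
  simp only [Matrix.mulVec, dotProduct, locMat, h1, h2, and_self, dif_pos, ite_mul, zero_mul]
  rw [← Finset.sum_filter]
  refine Finset.sum_nbij' (fun s => (s ⟨i - 1, by omega⟩, s ⟨i, h2⟩))
    (fun p => update₂ ⟨i - 1, by omega⟩ ⟨i, h2⟩ t p.1 p.2) ?_ ?_ ?_ ?_ ?_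
  · simp
  · simp [hne]
  · intro s hs
    exact (Finset.mem_filter.1 hs).2.symm
  · simp [hne]
  · intro s hs
    simp only [← (Finset.mem_filter.1 hs).2]

lemma tOp_eq {n i : ℕ} (h1 : 1 ≤ i) (h2 : i < n) : tOp n i = 1 + q • Uop n i := by
  have hq := q_ne_zero
  refine LinearMap.ext fun ψ => funext fun t => ?_
  have hself : ψ t = ψ (update₂ ⟨i - 1, by omega⟩ ⟨i, h2⟩ t (t ⟨i - 1, by omega⟩) (t ⟨i, h2⟩)) := by
    simp [update₂]
  simp only [tOp, Uop, LinearMap.add_apply, LinearMap.smul_apply, Module.End.one_apply,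
    Matrix.mulVecLin_apply, Pi.add_apply, Pi.smul_apply, smul_eq_mul, locMat_mulVec _ i h1 h2]
  rw [hself]
  cases t ⟨i - 1, by omega⟩ <;> cases t ⟨i, h2⟩ <;>
    simp [Fintype.sum_prod_type, tCoef, uCoef] <;> field_simp <;> ring

lemma tpOp_eq {n i : ℕ} (h1 : 1 ≤ i) (h2 : i < n) : tpOp n i = 1 + q⁻¹ • Uop n i := by
  have hq := q_ne_zero
  refine LinearMap.ext fun ψ => funext fun t => ?_
  have hself : ψ t = ψ (update₂ ⟨i - 1, by omega⟩ ⟨i, h2⟩ t (t ⟨i - 1, by omega⟩) (t ⟨i, h2⟩)) := by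
    simp [update₂]
  simp only [tpOp, Uop, LinearMap.add_apply, LinearMap.smul_apply, Module.End.one_apply,
    Matrix.mulVecLin_apply, Pi.add_apply, Pi.smul_apply, smul_eq_mul, locMat_mulVec _ i h1 h2]
  rw [hself]
  cases t ⟨i - 1, by omega⟩ <;> cases t ⟨i, h2⟩ <;>
    simp [Fintype.sum_prod_type, tpCoef, uCoef] <;> field_simp <;> ring

/-- Exchanging two opposite entries does not change a product of weights `g` with
`g true * g false = 1` over a set containing both positions or neither. -/
lemma prod_update₂ {n : ℕ} {g : Bool → Fq} (hg : g true * g false = 1) {S : Finset (Fin n)}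
    {i j : Fin n} (hij : i ≠ j) (hS : i ∈ S ↔ j ∈ S) {t : Fin n → Bool} {a b : Bool}
    (hab : b = !a) (ht : t j = !t i) :
    ∏ r ∈ S, g (update₂ i j t a b r) = ∏ r ∈ S, g (t r) := by
  have hg' : ∀ c, g c * g (!c) = 1 := by
    rintro (_ | _)
    · simpa [mul_comm] using hg
    · simpa using hg
  have hoff : ∀ r, r ≠ i → r ≠ j → g (update₂ i j t a b r) = g (t r) := by
    intro r h1 h2
    simp [h1, h2]
  by_cases hi : i ∈ S
  · have hj : j ∈ S.erase i := Finset.mem_erase.2 ⟨hij.symm, hS.1 hi⟩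
    rw [← Finset.mul_prod_erase _ _ hi, ← Finset.mul_prod_erase _ _ hj,
      ← Finset.mul_prod_erase _ (fun r => g (t r)) hi,
      ← Finset.mul_prod_erase _ (fun r => g (t r)) hj, ← mul_assoc, ← mul_assoc]
    congr 1
    · simp [hij, hab, ht, hg']
    · refine Finset.prod_congr rfl fun r hr => hoff r ?_ ?_ <;> rintro rfl <;> simp at hr
  · have hj : j ∉ S := fun h => hi (hS.2 h)
    refine Finset.prod_congr rfl fun r hr => hoff r ?_ ?_ <;> rintro rfl <;> contradiction

/-- `U_i` commutes with a weighted flip away from the two sites it acts on. -/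
lemma Uop_flipOp_of_ne {n i : ℕ} (h1 : 1 ≤ i) (h2 : i < n) (b : Bool) {g : Bool → Fq}
    (hg : g true * g false = 1) {S : Finset (Fin n)} {j : Fin n}
    (hS : (⟨i - 1, by omega⟩ : Fin n) ∈ S ↔ ⟨i, h2⟩ ∈ S)
    (hj0 : j ≠ ⟨i - 1, by omega⟩) (hj1 : j ≠ ⟨i, h2⟩) (ψ : Tens n) :
    Uop n i (flipOp b g S j ψ) = flipOp b g S j (Uop n i ψ) := by
  funext t
  have hne : (⟨i - 1, by omega⟩ : Fin n) ≠ ⟨i, h2⟩ := by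
    simp only [ne_eq, Fin.mk.injEq]; omega
  simp only [Uop, Matrix.mulVecLin_apply, flipOp, locMat_mulVec _ i h1 h2]
  by_cases ht : t j = b
  · simp only [Function.update_of_ne hj0, Function.update_of_ne hj1, ht, if_true,
      Function.update_of_ne hj0.symm, Function.update_of_ne hj1.symm, Finset.mul_sum]
    refine Finset.sum_congr rfl fun p _ => ?_
    rw [Function.update_comm hj1.symm, Function.update_comm hj0.symm]
    by_cases hu : p.2 = (!p.1) ∧ t ⟨i, h2⟩ = !t ⟨i - 1, by omega⟩
    · rw [prod_update₂ hg hne hS hu.1 hu.2]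
      ring
    · have : uCoef p.1 p.2 (t ⟨i - 1, by omega⟩) (t ⟨i, h2⟩) = 0 := by
        revert hu
        obtain ⟨a, b⟩ := p
        cases a <;> cases b <;> cases t ⟨i - 1, by omega⟩ <;> cases t ⟨i, h2⟩ <;> simp [uCoef]
      simp [this]
  · simp [ht, hj0, hj1]

/-- `U_i` commutes with a pair of flips at its two sites which is annihilated by it on both
sides; this is the case of `E` for `b = true` and of `F` for `b = false`. -/
lemma Uop_flipOp_pair {n i : ℕ} (h1 : 1 ≤ i) (h2 : i < n) (b : Bool) {g : Bool → Fq}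
    {S S0 S1 : Finset (Fin n)} (h0S : (⟨i - 1, by omega⟩ : Fin n) ∉ S) (h1S : ⟨i, h2⟩ ∉ S)
    (h : b = true ∧ g = kval ∧ S0 = S ∧ S1 = insert ⟨i - 1, by omega⟩ S ∨
      b = false ∧ g = (fun c => (kval c)⁻¹) ∧ S0 = insert ⟨i, h2⟩ S ∧ S1 = S) (ψ : Tens n) :
    Uop n i (flipOp b g S0 ⟨i - 1, by omega⟩ ψ + flipOp b g S1 ⟨i, h2⟩ ψ) =
      flipOp b g S0 ⟨i - 1, by omega⟩ (Uop n i ψ) + flipOp b g S1 ⟨i, h2⟩ (Uop n i ψ) := by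
  have hq := q_ne_zero
  funext t
  have hne : (⟨i - 1, by omega⟩ : Fin n) ≠ ⟨i, h2⟩ := by
    simp only [ne_eq, Fin.mk.injEq]; omega
  simp only [Uop, Matrix.mulVecLin_apply, flipOp, locMat_mulVec _ i h1 h2, Pi.add_apply]
  generalize (⟨i - 1, by omega⟩ : Fin n) = x at *
  generalize (⟨i, h2⟩ : Fin n) = y at *
  have hprod : ∀ a c, ∏ r ∈ S, g (update₂ x y t a c r) = ∏ r ∈ S, g (t r) := by
    refine fun a c => Finset.prod_congr rfl fun r hr => ?_
    rw [update₂, Function.update_of_ne, Function.update_of_ne] <;> rintro rfl <;> contradiction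
  have hx : ∀ a c d, Function.update (update₂ x y t a c) x d = update₂ x y t d c := by
    intro a c d
    rw [update₂, Function.update_comm hne.symm, Function.update_idem]
  have hx' : ∀ a c d, update₂ x y (Function.update t x d) a c = update₂ x y t a c := by
    intro a c d
    rw [update₂, Function.update_idem]
  have hy' : ∀ a c d, update₂ x y (Function.update t y d) a c = update₂ x y t a c := by
    intro a c d
    rw [update₂, Function.update_comm hne.symm, Function.update_idem]
  have hy : ∀ a c d, Function.update (update₂ x y t a c) y d = update₂ x y t a d := by
    intro a c d
    rw [update₂, Function.update_idem]
  have hux : ∀ a c, update₂ x y t a c x = a := by simp [hne]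
  have huy : ∀ a c, update₂ x y t a c y = c := by simp
  simp only [hx, hy, hx', hy', hux, huy, Function.update_self, Function.update_of_ne hne,
    Function.update_of_ne hne.symm]
  generalize update₂ x y t = u at *
  rcases h with ⟨rfl, rfl, rfl, rfl⟩ | ⟨rfl, rfl, rfl, rfl⟩ <;>
    simp only [Finset.prod_insert h0S, Finset.prod_insert h1S, hprod, hux, huy,
      Fintype.sum_prod_type, Fintype.sum_bool] <;>
    cases t x <;> cases t y <;> simp [uCoef, kval] <;> field_simp <;> ring

lemma Uop_sum_flipOp {n i : ℕ} (h1 : 1 ≤ i) (h2 : i < n) (b : Bool) {g : Bool → Fq}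
    (hg : g true * g false = 1) (T : Fin n → Finset (Fin n))
    (hmem : ∀ j, j ≠ ⟨i - 1, by omega⟩ → j ≠ ⟨i, h2⟩ →
      ((⟨i - 1, by omega⟩ : Fin n) ∈ T j ↔ ⟨i, h2⟩ ∈ T j))
    {S : Finset (Fin n)} (h0S : (⟨i - 1, by omega⟩ : Fin n) ∉ S) (h1S : ⟨i, h2⟩ ∉ S)
    (h : b = true ∧ g = kval ∧ T ⟨i - 1, by omega⟩ = S ∧
        T ⟨i, h2⟩ = insert ⟨i - 1, by omega⟩ S ∨
      b = false ∧ g = (fun c => (kval c)⁻¹) ∧ T ⟨i - 1, by omega⟩ = insert ⟨i, h2⟩ S ∧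
        T ⟨i, h2⟩ = S) (ψ : Tens n) :
    Uop n i (∑ j, flipOp b g (T j) j ψ) = ∑ j, flipOp b g (T j) j (Uop n i ψ) := by
  have hne : (⟨i, h2⟩ : Fin n) ≠ ⟨i - 1, by omega⟩ := by
    simp only [ne_eq, Fin.mk.injEq]; omega
  have hy : (⟨i, h2⟩ : Fin n) ∈ Finset.univ.erase ⟨i - 1, by omega⟩ := by simp [hne]
  rw [← Finset.add_sum_erase _ _ (Finset.mem_univ (⟨i - 1, by omega⟩ : Fin n)),
    ← Finset.add_sum_erase _ _ hy, ← add_assoc, map_add, map_sum,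
    Uop_flipOp_pair h1 h2 b h0S h1S h,
    ← Finset.add_sum_erase _ (fun j => flipOp b g (T j) j (Uop n i ψ))
      (Finset.mem_univ (⟨i - 1, by omega⟩ : Fin n)),
    ← Finset.add_sum_erase _ (fun j => flipOp b g (T j) j (Uop n i ψ)) hy, ← add_assoc]
  congr 1
  refine Finset.sum_congr rfl fun j hj => ?_
  simp only [Finset.mem_erase, Finset.mem_univ, and_true] at hj
  exact Uop_flipOp_of_ne h1 h2 b hg (hmem j hj.2 hj.1) hj.2 hj.1 ψ

lemma commute_Uop_Eop {n i : ℕ} (h1 : 1 ≤ i) (h2 : i < n) : Commute (Uop n i) (Eop n) := by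
  refine LinearMap.ext fun ψ => ?_
  simp only [Module.End.mul_apply, Eop_apply]
  refine Uop_sum_flipOp h1 h2 true (by simp [kval, q_ne_zero]) _ ?_
    (S := Finset.univ.filter fun r => r < ⟨i - 1, by omega⟩) (by simp) (by simp [Fin.lt_def])
    (Or.inl ⟨rfl, rfl, rfl, ?_⟩) ψ
  · intro j hj0 hj1
    rw [ne_eq, Fin.ext_iff] at hj0 hj1
    simp only [Finset.mem_filter_univ, Fin.lt_def]
    dsimp only at hj0 hj1
    omega
  · ext r
    simp only [Finset.mem_filter_univ, Finset.mem_insert, Fin.lt_def, Fin.ext_iff]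
    omega

lemma commute_Uop_Fop {n i : ℕ} (h1 : 1 ≤ i) (h2 : i < n) : Commute (Uop n i) (Fop n) := by
  refine LinearMap.ext fun ψ => ?_
  simp only [Module.End.mul_apply, Fop_apply]
  refine Uop_sum_flipOp h1 h2 false (by simp [kval, q_ne_zero]) _ ?_
    (S := Finset.univ.filter fun r => ⟨i, h2⟩ < r) (by simp [Fin.lt_def]) (by simp)
    (Or.inr ⟨rfl, rfl, ?_, rfl⟩) ψ
  · intro j hj0 hj1
    rw [ne_eq, Fin.ext_iff] at hj0 hj1
    simp only [Finset.mem_filter_univ, Fin.lt_def]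
    dsimp only at hj0 hj1
    omega
  · ext r
    simp only [Finset.mem_filter_univ, Finset.mem_insert, Fin.lt_def, Fin.ext_iff]
    omega

/-- the operators `t_i`, `t_i′`, `U_i` commute with the quantum `sl₂`
operators `E` and `F` on `V^{⊗n}`. -/
theorem operators_commute_with_quantum_sl2 (n : ℕ) (hn : 2 ≤ n)
    (i : ℕ) (hi1 : 1 ≤ i) (hi2 : i ≤ n - 1) :
    tOp n i ∘ₗ Eop n = Eop n ∘ₗ tOp n i ∧
    tOp n i ∘ₗ Fop n = Fop n ∘ₗ tOp n i ∧
    tpOp n i ∘ₗ Eop n = Eop n ∘ₗ tpOp n i ∧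
    tpOp n i ∘ₗ Fop n = Fop n ∘ₗ tpOp n i ∧
    Uop n i ∘ₗ Eop n = Eop n ∘ₗ Uop n i ∧
    Uop n i ∘ₗ Fop n = Fop n ∘ₗ Uop n i := by
  have h2 : i < n := by omega
  have hE := commute_Uop_Eop hi1 h2
  have hF := commute_Uop_Fop hi1 h2
  rw [tOp_eq hi1 h2, tpOp_eq hi1 h2]
  exact ⟨(Commute.one_left _).add_left (hE.smul_left q),
    (Commute.one_left _).add_left (hF.smul_left q),
    (Commute.one_left _).add_left (hE.smul_left q⁻¹),
    (Commute.one_left _).add_left (hF.smul_left q⁻¹), hE, hF⟩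
end
end

section
/- Let k be a field of prime characteristic p, let k₀ ≥ 0 and n := k₀·p + 2, and let C := k[x]/(x^n) with the k-linear derivation ∂ determined by ∂(x) = x² (so ∂(x^a) = a·x^{a+1}). Let W ⊆ C be the k-span of x, x², …, x^{k₀p}, and U ⊆ C the k-span of 1 and x^{k₀p+1}. Then C = W ⊕ U as k-vector spaces, ∂(W) ⊆ W, ∂(U) = 0, and W is acyclic: ker(∂^i) ∩ W = ∂^{p−i}(W) for every 1 ≤ i ≤ p−1. Consequently (C, ∂) is quasi-isomorphic as a p-complex to the two-dimensional space k·1 ⊕ k·x^{k₀p+1} with zero differential. -/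
set_option maxHeartbeats 1000000
set_option synthInstance.maxHeartbeats 400000

noncomputable section

/-- The matrix of the derivation `∂` of `C = k[x]/(xⁿ)` with `∂(x) = x²`, i.e.
`∂(x^a) = a·x^{a+1}` (truncated at `xⁿ = 0`), in the basis `1, x, …, x^{n-1}`. -/
def truncDerMat (k : Type*) [Field k] (n : ℕ) : Matrix (Fin n) (Fin n) k :=
  fun b a => if b.val = a.val + 1 then (a.val : k) else 0

/-- The derivation `∂` on `C = k[x]/(xⁿ)` (coordinates w.r.t. the basis `x^a`). -/
def truncDer (k : Type*) [Field k] (n : ℕ) : ((Fin n → k) →ₗ[k] (Fin n → k)) :=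
  (truncDerMat k n).mulVecLin

/-- The subspace `W ⊆ C = k[x]/(x^{k₀p+2})` spanned by `x, x², …, x^{k₀p}`. -/
def midSpan (k : Type*) [Field k] (p k₀ n : ℕ) : Submodule k (Fin n → k) :=
  Submodule.pi Set.univ
    (fun j : Fin n => if j.val = 0 ∨ j.val = k₀ * p + 1 then (⊥ : Submodule k k) else ⊤)

/-- The subspace `U ⊆ C = k[x]/(x^{k₀p+2})` spanned by `1` and `x^{k₀p+1}`. -/
def endsSpan (k : Type*) [Field k] (p k₀ n : ℕ) : Submodule k (Fin n → k) :=
  Submodule.pi Set.univ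
    (fun j : Fin n => if 1 ≤ j.val ∧ j.val ≤ k₀ * p then (⊥ : Submodule k k) else ⊤)

theorem truncDer_apply (k : Type*) [Field k] (n : ℕ) (v : Fin n → k) (b : Fin n) :
    truncDer k n v b = ((b.val - 1 : ℕ) : k) * v ⟨b.val - 1, by omega⟩ := by
  simp only [truncDer, truncDerMat, Matrix.mulVecLin_apply, Matrix.mulVec, dotProduct]
  rw [Finset.sum_eq_single (⟨b.val - 1, by omega⟩ : Fin n)]
  · rcases Nat.eq_zero_or_pos b.val with h | h
    · simp [h]
    · rw [if_pos (by simp only; omega)]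
  · intro a _ ha
    rw [if_neg, zero_mul]
    intro h
    exact ha (Fin.ext (by simp only; omega))
  · simp

theorem truncDer_iterate_apply (k : Type*) [Field k] (n i : ℕ) (v : Fin n → k) (b : Fin n) :
    (⇑(truncDer k n))^[i] v b =
      ((b.val - 1).descFactorial i : k) * v ⟨b.val - i, by omega⟩ := by
  induction i generalizing b with
  | zero => simp
  | succ i ih =>
    rw [Function.iterate_succ_apply', truncDer_apply, ih]
    obtain ⟨b, hb⟩ := b
    rcases b with _ | _ | b
    · simp
    · simp
    · simp only [Nat.add_sub_cancel, Nat.succ_descFactorial_succ, Nat.cast_mul,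
        show b + 1 + 1 - (i + 1) = b + 1 - i by omega, mul_assoc]

theorem natCast_descFactorial_eq_zero_iff (k : Type*) [Field k] (p : ℕ) (hp : p.Prime)
    [CharP k p] (m i : ℕ) : (m.descFactorial i : k) = 0 ↔ m % p < i := by
  rw [CharP.cast_eq_zero_iff k p, Nat.descFactorial_eq_prod_range,
    hp.prime.dvd_finsetProd_iff]
  constructor
  · rintro ⟨t, ht, hd⟩
    rw [Finset.mem_range] at ht
    rcases le_total t m with h | h
    · have : m % p = t % p := ((Nat.modEq_iff_dvd' h).mpr hd).symm
      exact this ▸ (Nat.mod_le t p).trans_lt ht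
    · exact ((Nat.mod_le m p).trans h).trans_lt ht
  · exact fun h => ⟨m % p, Finset.mem_range.mpr h, Nat.dvd_sub_mod m⟩

theorem truncDer_iterate_eq_zero_iff (k : Type*) [Field k] (p : ℕ) (hp : p.Prime)
    [CharP k p] (n i : ℕ) (v : Fin n → k) :
    (⇑(truncDer k n))^[i] v = 0 ↔
      ∀ b : Fin n, (b.val - 1) % p < i ∨ v ⟨b.val - i, by omega⟩ = 0 := by
  simp only [funext_iff, truncDer_iterate_apply, Pi.zero_apply, mul_eq_zero,
    natCast_descFactorial_eq_zero_iff k p hp]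

theorem mem_midSpan_iff (k : Type*) [Field k] (p k₀ n : ℕ) (v : Fin n → k) :
    v ∈ midSpan k p k₀ n ↔ ∀ j : Fin n, j.val = 0 ∨ j.val = k₀ * p + 1 → v j = 0 := by
  simp only [midSpan, Submodule.mem_pi, Set.mem_univ, true_imp_iff]
  refine forall_congr' fun j => ?_
  split_ifs with h <;> simp [h]

theorem mem_endsSpan_iff (k : Type*) [Field k] (p k₀ n : ℕ) (v : Fin n → k) :
    v ∈ endsSpan k p k₀ n ↔ ∀ j : Fin n, 1 ≤ j.val ∧ j.val ≤ k₀ * p → v j = 0 := by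
  simp only [endsSpan, Submodule.mem_pi, Set.mem_univ, true_imp_iff]
  refine forall_congr' fun j => ?_
  split_ifs with h <;> simp [h]

theorem exists_midSpan_add_endsSpan (k : Type*) [Field k] (p k₀ n : ℕ)
    (v : Fin n → k) : ∃ w ∈ midSpan k p k₀ n, ∃ u ∈ endsSpan k p k₀ n, w + u = v := by
  refine ⟨fun j => if 1 ≤ j.val ∧ j.val ≤ k₀ * p then v j else 0, ?_,
    fun j => if 1 ≤ j.val ∧ j.val ≤ k₀ * p then 0 else v j, ?_, ?_⟩
  · rw [mem_midSpan_iff]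
    intro j hj
    exact if_neg (by omega)
  · rw [mem_endsSpan_iff]
    intro j hj
    exact if_pos hj
  · ext j
    by_cases h : 1 ≤ j.val ∧ j.val ≤ k₀ * p <;> simp [h]

theorem truncDer_eq_zero_of_mem_endsSpan (k : Type*) [Field k] (p k₀ n : ℕ)
    (hn : n = k₀ * p + 2) (v : Fin n → k) (hv : v ∈ endsSpan k p k₀ n) :
    truncDer k n v = 0 := by
  rw [mem_endsSpan_iff] at hv
  ext b
  rw [truncDer_apply]
  rcases Nat.lt_or_ge b.val 2 with h | h
  · simp [show b.val - 1 = 0 by omega]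
  · rw [hv _ ⟨by simp only; omega, by simp only; omega⟩, mul_zero, Pi.zero_apply]

theorem truncDer_iterate_char (k : Type*) [Field k] (p : ℕ) (hp : p.Prime) [CharP k p]
    (n : ℕ) (v : Fin n → k) : (⇑(truncDer k n))^[p] v = 0 :=
  (truncDer_iterate_eq_zero_iff k p hp n p v).mpr fun _ => .inl (Nat.mod_lt _ hp.pos)

theorem truncDer_iterate_iterate_sub (k : Type*) [Field k] (p : ℕ) (hp : p.Prime) [CharP k p]
    (n i : ℕ) (hi : i ≤ p) (w : Fin n → k) :
    (⇑(truncDer k n))^[i] ((⇑(truncDer k n))^[p - i] w) = 0 := by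
  rw [← Function.iterate_add_apply, Nat.add_sub_cancel' hi, truncDer_iterate_char k p hp]

theorem add_le_mul_of_pred_mod_add_lt {p k₀ b i : ℕ} (hb : 1 ≤ b) (hbk : b ≤ k₀ * p)
    (hr : (b - 1) % p + i < p) : b + i ≤ k₀ * p := by
  have hdiv := Nat.div_add_mod (b - 1) p
  have hq : (b - 1) / p < k₀ := Nat.div_lt_of_lt_mul (by rw [mul_comm]; omega)
  have hmul : p * ((b - 1) / p + 1) ≤ p * k₀ := Nat.mul_le_mul_left p hq
  rw [mul_add, mul_one, mul_comm p k₀] at hmul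
  omega

theorem exists_midSpan_iterate_eq (k : Type*) [Field k] (p : ℕ) (hp : p.Prime) [CharP k p]
    (k₀ n : ℕ) (hn : n = k₀ * p + 2) (i : ℕ) (hi : i < p) (v : Fin n → k)
    (hv : v ∈ midSpan k p k₀ n) (hker : (⇑(truncDer k n))^[i] v = 0) :
    ∃ w ∈ midSpan k p k₀ n, (⇑(truncDer k n))^[p - i] w = v := by
  rw [mem_midSpan_iff] at hv
  rw [truncDer_iterate_eq_zero_iff k p hp] at hker
  refine ⟨fun a => if h : a.val + (p - i) < n then
    ((a.val + (p - i) - 1).descFactorial (p - i) : k)⁻¹ * v ⟨a.val + (p - i), h⟩ else 0,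
    ?_, ?_⟩
  · rw [mem_midSpan_iff]
    rintro a (ha | ha)
    · split_ifs with h
      · rw [(natCast_descFactorial_eq_zero_iff k p hp _ _).mpr, inv_zero, zero_mul]
        exact (Nat.mod_le _ _).trans_lt (by omega)
      · rfl
    · exact dif_neg (by omega)
  · ext b
    rw [truncDer_iterate_apply]
    by_cases hc : (b.val - 1) % p < p - i
    · rw [(natCast_descFactorial_eq_zero_iff k p hp _ _).mpr hc, zero_mul]
      by_cases hb : 1 ≤ b.val ∧ b.val ≤ k₀ * p
      · have hbi := add_le_mul_of_pred_mod_add_lt (i := i) hb.1 hb.2 (by omega)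
        have hmod : (b.val + i - 1) % p = (b.val - 1) % p + i := by
          rw [show b.val + i - 1 = b.val - 1 + i by omega, Nat.add_mod,
            Nat.mod_eq_of_lt hi, Nat.mod_eq_of_lt (by omega)]
        rcases hker ⟨b.val + i, by omega⟩ with h | h
        · simp only at h
          omega
        · simpa using h.symm
      · exact (hv b (by omega)).symm
    · have hle := Nat.mod_le (b.val - 1) p
      have hb : b.val - (p - i) + (p - i) = b.val := by omega
      have hne : ((b.val - 1).descFactorial (p - i) : k) ≠ 0 := fun h =>
        hc ((natCast_descFactorial_eq_zero_iff k p hp _ _).mp h)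
      simp only [hb, b.isLt, dif_pos, Fin.eta]
      exact mul_inv_cancel_left₀ hne _

/-- for `n = k₀p + 2` and `C = k[x]/(xⁿ)` with the derivation `∂(x) = x²`:
`C = W ⊕ U` where `W = span(x, …, x^{k₀p})` and `U = span(1, x^{k₀p+1})`; `∂(W) ⊆ W`,
`∂(U) = 0`, and `W` is acyclic (`ker(∂^i) ∩ W = ∂^{p-i}(W)` for `1 ≤ i ≤ p-1`).
Consequently `(C, ∂)` is quasi-isomorphic as a `p`-complex to the two-dimensional space
`U` with zero differential: every `∂^i`-cycle is `u + ∂^{p-i}(w)` with `u ∈ U`, and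
`u ∈ U ∩ im(∂^{p-i})` only for `u = 0`. -/
theorem truncated_ring_quasi_iso_two_dim (k : Type*) [Field k] (p : ℕ) (hp : p.Prime)
    [CharP k p] (k₀ n : ℕ) (hn : n = k₀ * p + 2) :
    (midSpan k p k₀ n ⊓ endsSpan k p k₀ n = ⊥ ∧
      midSpan k p k₀ n ⊔ endsSpan k p k₀ n = ⊤) ∧
    (∀ v ∈ midSpan k p k₀ n, truncDer k n v ∈ midSpan k p k₀ n) ∧
    (∀ v ∈ endsSpan k p k₀ n, truncDer k n v = 0) ∧
    (∀ i : ℕ, 1 ≤ i → i ≤ p - 1 → ∀ v ∈ midSpan k p k₀ n,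
      ((⇑(truncDer k n))^[i] v = 0 ↔
        ∃ w ∈ midSpan k p k₀ n, (⇑(truncDer k n))^[p - i] w = v)) ∧
    (∀ i : ℕ, 1 ≤ i → i ≤ p - 1 →
      (∀ v : Fin n → k, (⇑(truncDer k n))^[i] v = 0 ↔
        ∃ u ∈ endsSpan k p k₀ n, ∃ w, v = u + (⇑(truncDer k n))^[p - i] w) ∧
      (∀ u ∈ endsSpan k p k₀ n,
        (∃ w, u = (⇑(truncDer k n))^[p - i] w) → u = 0)) := by
  have hends := truncDer_eq_zero_of_mem_endsSpan k p k₀ n hn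
  refine ⟨⟨?_, ?_⟩, ?_, hends, ?_, ?_⟩
  · rw [eq_bot_iff]
    rintro v ⟨hw, hu⟩
    rw [SetLike.mem_coe, mem_midSpan_iff] at hw
    rw [SetLike.mem_coe, mem_endsSpan_iff] at hu
    rw [Submodule.mem_bot]
    ext j
    by_cases h : 1 ≤ j.val ∧ j.val ≤ k₀ * p
    · exact hu j h
    · exact hw j (by omega)
  · rw [eq_top_iff]
    exact fun v _ => Submodule.mem_sup.mpr (exists_midSpan_add_endsSpan k p k₀ n v)
  · intro v _
    rw [mem_midSpan_iff]
    rintro j (hj | hj) <;> simp [truncDer_apply, hj]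
  · intro i _ hi v hv
    refine ⟨exists_midSpan_iterate_eq k p hp k₀ n hn i (by have := hp.pos; omega) v hv, ?_⟩
    rintro ⟨w, -, rfl⟩
    exact truncDer_iterate_iterate_sub k p hp n i (by omega) w
  · intro i hi1 hi
    have hip : i < p := by have := hp.pos; omega
    have hzero : ∀ u ∈ endsSpan k p k₀ n, (⇑(truncDer k n))^[i] u = 0 := by
      intro u hu
      obtain ⟨j, rfl⟩ := Nat.exists_eq_add_of_le' hi1
      rw [Function.iterate_succ_apply, hends u hu, iterate_map_zero]
    refine ⟨fun v => ⟨fun hv => ?_, ?_⟩, ?_⟩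
    · obtain ⟨w₀, hw₀, u, hu, rfl⟩ := exists_midSpan_add_endsSpan k p k₀ n v
      rw [iterate_map_add, hzero u hu, add_zero] at hv
      obtain ⟨w, -, rfl⟩ := exists_midSpan_iterate_eq k p hp k₀ n hn i hip w₀ hw₀ hv
      exact ⟨u, hu, w, add_comm _ _⟩
    · rintro ⟨u, hu, w, rfl⟩
      rw [iterate_map_add, hzero u hu, truncDer_iterate_iterate_sub k p hp n i hip.le, add_zero]
    · rintro u hu ⟨w, rfl⟩
      rw [mem_endsSpan_iff] at hu
      ext b
      by_cases h : 1 ≤ b.val ∧ b.val ≤ k₀ * p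
      · exact hu b h
      · rw [truncDer_iterate_apply, (natCast_descFactorial_eq_zero_iff k p hp _ _).mpr,
          zero_mul, Pi.zero_apply]
        have hb : b.val - 1 = 0 ∨ b.val - 1 = k₀ * p := by omega
        rcases hb with hb | hb <;> simp [hb, hip]
end
end
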